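/- (The dual of the general adversary bound is span program witness size.) Let f : {0,1}^n → {0,1} be nonconstant. Then sup_Γ ‖Γ‖ / max_{i ∈ [n]} ‖Γ ∘ D_i‖, where the supremum is over nonzero adversary matrices Γ for f, equals inf_X max_{s ∈ {0,1}^n} Σ_{j ∈ [n]} ⟨s,j|X|s,j⟩, where the infimum is over positive semidefinite matrices X indexed by {0,1}^n × [n] satisfying Σ_{j : w_j ≠ x_j} ⟨w,j|X|x,j⟩ = 1 for every w ∈ f⁻¹(0) and x ∈ f⁻¹(1). -/

import Mathlib

open scoped Matrix ComplexOrder Classical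

/-- The spectral norm (largest singular value) of a complex matrix. -/
noncomputable def specNorm {X Y : Type*} [Fintype X] [Fintype Y] [DecidableEq Y]
    (A : Matrix X Y ℂ) : ℝ :=
  ‖LinearMap.toContinuousLinearMap (Matrix.toEuclideanLin A)‖

section QuadForm

variable {S : Type*} [Fintype S]

/-- The real part of the quadratic form `v ↦ v* A v`. -/
noncomputable def quadForm (A : Matrix S S ℂ) (v : S → ℂ) : ℝ :=
  (∑ x, ∑ y, star (v x) * A x y * v y).re

lemma quadForm_add_conjTranspose (A : Matrix S S ℂ) (v : S → ℂ) :
    quadForm (A + Aᴴ) v = 2 * quadForm A v := by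
  have h : ∑ x, ∑ y, star (v x) * Aᴴ x y * v y = star (∑ x, ∑ y, star (v x) * A x y * v y) := by
    rw [Finset.sum_comm]
    simp only [star_sum, star_mul', star_star, Matrix.conjTranspose_apply]
    exact Finset.sum_congr rfl fun x _ => Finset.sum_congr rfl fun y _ => by ring
  have h' : (∑ x, ∑ y, star (v x) * Aᴴ x y * v y).re = quadForm A v := by
    rw [h]; rfl
  simp only [quadForm, Matrix.add_apply, mul_add, add_mul, Finset.sum_add_distrib,
    Complex.add_re] at *
  rw [h']; ring

lemma quadForm_of_mul_mul (A : Matrix S S ℂ) (c : S → ℝ) (v : S → ℂ) :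
    quadForm (Matrix.of fun x y => (c x : ℂ) * A x y * c y) v =
      quadForm A fun x => c x * v x := by
  simp only [quadForm, Matrix.of_apply, star_mul', Complex.star_def, Complex.conj_ofReal]
  congr 1
  exact Finset.sum_congr rfl fun x _ => Finset.sum_congr rfl fun y _ => by ring

variable [DecidableEq S]

lemma reApplyInnerSelf_toEuclideanLin (A : Matrix S S ℂ) (v : EuclideanSpace ℂ S) :
    (LinearMap.toContinuousLinearMap (Matrix.toEuclideanLin A)).reApplyInnerSelf v =
      quadForm A v.ofLp := by
  rw [ContinuousLinearMap.reApplyInnerSelf_apply, inner_re_symm,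
    EuclideanSpace.inner_eq_star_dotProduct]
  simp only [quadForm, LinearMap.coe_toContinuousLinearMap', Matrix.toEuclideanLin,
    Matrix.ofLp_toLpLin, Matrix.toLin'_apply,
    dotProduct, Matrix.mulVec, Finset.sum_mul, RCLike.re_to_complex, Pi.star_apply]
  congr 1
  exact Finset.sum_congr rfl fun x _ => Finset.sum_congr rfl fun y _ => by ring

lemma specNorm_nonneg (A : Matrix S S ℂ) : 0 ≤ specNorm A := norm_nonneg _

lemma abs_quadForm_le (A : Matrix S S ℂ) (v : S → ℂ) :
    |quadForm A v| ≤ specNorm A * ∑ x, ‖v x‖ ^ 2 := by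
  have h := (LinearMap.toContinuousLinearMap (Matrix.toEuclideanLin A)).rayleighQuotient_le_norm
    (WithLp.toLp 2 v)
  rw [ContinuousLinearMap.rayleighQuotient, reApplyInnerSelf_toEuclideanLin,
    EuclideanSpace.norm_sq_eq, abs_div] at h
  have h0 : 0 ≤ ∑ x, ‖v x‖ ^ 2 := by positivity
  rcases h0.eq_or_lt with h1 | h1
  · have hv : v = 0 := by
      ext x
      have := (Finset.sum_eq_zero_iff_of_nonneg fun x _ => sq_nonneg ‖v x‖).1 h1.symm x
        (Finset.mem_univ x)
      simpa using this
    simp [hv, quadForm]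
  · rwa [abs_of_pos h1, div_le_iff₀ h1] at h

lemma specNorm_le_of_abs_quadForm_le {A : Matrix S S ℂ} (hA : A.IsHermitian) {C : ℝ} (hC : 0 ≤ C)
    (h : ∀ v : S → ℂ, |quadForm A v| ≤ C * ∑ x, ‖v x‖ ^ 2) : specNorm A ≤ C := by
  rw [specNorm, ContinuousLinearMap.norm_eq_iSup_rayleighQuotient]
  · refine ciSup_le fun v => ?_
    rw [ContinuousLinearMap.rayleighQuotient, reApplyInnerSelf_toEuclideanLin, abs_div, abs_sq,
      EuclideanSpace.norm_sq_eq]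
    exact div_le_of_le_mul₀ (by positivity) hC (h _)
  · exact Matrix.isSymmetric_toEuclideanLin_iff.2 hA

end QuadForm

section PosSemidef

variable {m : Type*} [Fintype m] [DecidableEq m]

lemma Matrix.PosSemidef.exists_eq_conjTranspose_mul_self {X : Matrix m m ℂ} (hX : X.PosSemidef) :
    ∃ B : Matrix m m ℂ, X = Bᴴ * B := by
  open scoped MatrixOrder in
  exact (CStarAlgebra.nonneg_iff_eq_star_mul_self).1 hX.nonneg

end PosSemidef

section RealDual

variable {S T : Type*} [Fintype S] [Fintype T] [DecidableEq S] [DecidableEq T]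

lemma exists_eq_re_sum_mul (ψ : (S → T → ℂ) →ₗ[ℝ] ℝ) :
    ∃ γ : S → T → ℂ, ∀ M, ψ M = (∑ x, ∑ y, γ x y * M x y).re := by
  let E (x : S) (y : T) (z : ℂ) : S → T → ℂ := Pi.single x (Pi.single y z)
  refine ⟨fun x y => ψ (E x y 1) - ψ (E x y Complex.I) * Complex.I, fun M => ?_⟩
  have hM : M = ∑ x, ∑ y, ((M x y).re • E x y 1 + (M x y).im • E x y Complex.I) := by
    have hE : ∀ x y, (M x y).re • E x y 1 + (M x y).im • E x y Complex.I = E x y (M x y) := by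
      intro x y
      simp only [E, ← Pi.single_smul, ← Pi.single_add]
      simp [Complex.re_add_im]
    simp only [hE]
    ext a b
    simp [E, Finset.sum_apply, Pi.single_apply, ite_apply]
  conv_lhs => rw [hM]
  simp only [map_sum, map_add, map_smul, Complex.re_sum]
  refine Finset.sum_congr rfl fun x _ => Finset.sum_congr rfl fun y _ => ?_
  simp
  ring

end RealDual

section Adversary

variable {n : ℕ}

/-- The Hadamard product `Γ ∘ D_i`. -/
noncomputable def diffPart (Γ : Matrix (Fin n → Bool) (Fin n → Bool) ℂ) (i : Fin n) :
    Matrix (Fin n → Bool) (Fin n → Bool) ℂ :=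
  Matrix.of fun x y => if x i ≠ y i then Γ x y else 0

/-- The sum `Σ_{j : w_j ≠ x_j} ⟨w,j|X|x,j⟩`. -/
noncomputable def crossSum (X : Matrix ((Fin n → Bool) × Fin n) ((Fin n → Bool) × Fin n) ℂ)
    (w x : Fin n → Bool) : ℂ :=
  ∑ j ∈ Finset.univ.filter (fun j => w j ≠ x j), X (w, j) (x, j)

/-- The sum `Σ_j ⟨s,j|X|s,j⟩`. -/
noncomputable def diagSum (X : Matrix ((Fin n → Bool) × Fin n) ((Fin n → Bool) × Fin n) ℂ)
    (s : Fin n → Bool) : ℝ :=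
  ∑ j : Fin n, (X (s, j) (s, j)).re

/-- Feasibility of `X` in the witness size program of `f`. -/
def IsWitness (f : (Fin n → Bool) → Bool)
    (X : Matrix ((Fin n → Bool) × Fin n) ((Fin n → Bool) × Fin n) ℂ) : Prop :=
  X.PosSemidef ∧ ∀ w x, f w = false → f x = true → crossSum X w x = 1

lemma diagSum_conjTranspose_mul_self
    (B : Matrix ((Fin n → Bool) × Fin n) ((Fin n → Bool) × Fin n) ℂ) (s : Fin n → Bool) :
    diagSum (Bᴴ * B) s = ∑ j, ∑ z, ‖B z (s, j)‖ ^ 2 := by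
  simp only [diagSum, Matrix.mul_apply, Matrix.conjTranspose_apply, Complex.re_sum]
  refine Finset.sum_congr rfl fun j _ => Finset.sum_congr rfl fun z _ => ?_
  rw [Complex.star_def, ← Complex.normSq_eq_conj_mul_self, Complex.ofReal_re,
    Complex.normSq_eq_norm_sq]

lemma diagSum_nonneg {X : Matrix ((Fin n → Bool) × Fin n) ((Fin n → Bool) × Fin n) ℂ}
    (hX : X.PosSemidef) (s : Fin n → Bool) : 0 ≤ diagSum X s := by
  obtain ⟨B, rfl⟩ := hX.exists_eq_conjTranspose_mul_self
  rw [diagSum_conjTranspose_mul_self]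
  positivity

lemma quadForm_mul_crossSum (M : Matrix (Fin n → Bool) (Fin n → Bool) ℂ)
    (B : Matrix ((Fin n → Bool) × Fin n) ((Fin n → Bool) × Fin n) ℂ) (v : (Fin n → Bool) → ℂ) :
    quadForm (Matrix.of fun x y => M x y * crossSum (Bᴴ * B) x y) v =
      ∑ j, ∑ z, quadForm (diffPart M j) fun x => B z (x, j) * v x := by
  simp only [quadForm, ← Complex.re_sum]
  congr 1
  simp only [crossSum, Matrix.of_apply, Finset.sum_filter, Matrix.mul_apply, diffPart,
    Matrix.conjTranspose_apply, Finset.mul_sum, Finset.sum_mul]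
  have h : ∀ j : Fin n, ∑ z : (Fin n → Bool) × Fin n, ∑ x, ∑ y, star (B z (x, j) * v x) *
      (if x j ≠ y j then M x y else 0) * (B z (y, j) * v y) =
      ∑ x, ∑ y, ∑ z, star (B z (x, j) * v x) *
      (if x j ≠ y j then M x y else 0) * (B z (y, j) * v y) := fun j => by
    rw [Finset.sum_comm]
    exact Finset.sum_congr rfl fun x _ => Finset.sum_comm
  simp only [h]
  conv_rhs => rw [Finset.sum_comm]
  refine Finset.sum_congr rfl fun x _ => ?_
  conv_rhs => rw [Finset.sum_comm]
  refine Finset.sum_congr rfl fun y _ => Finset.sum_congr rfl fun j _ => ?_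
  split_ifs
  · simp only [Finset.mul_sum, Finset.sum_mul]
    refine Finset.sum_congr rfl fun z _ => ?_
    rw [star_mul']
    ring
  · simp

lemma IsWitness.crossSum_eq_one {f : (Fin n → Bool) → Bool}
    {X : Matrix ((Fin n → Bool) × Fin n) ((Fin n → Bool) × Fin n) ℂ} (hX : IsWitness f X)
    {x y : Fin n → Bool} (h : f x ≠ f y) : crossSum X x y = 1 := by
  cases hx : f x with
  | false => exact hX.2 x y hx (by simpa [hx] using h)
  | true =>
    have := hX.2 y x (by simpa [hx] using h) hx
    rw [← star_inj, star_one, ← this, crossSum, crossSum, star_sum]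
    simp only [ne_comm (a := x _)]
    exact Finset.sum_congr rfl fun j _ => hX.1.isHermitian.apply _ _

/-- Weak duality between adversary matrices and span program witnesses. -/
lemma specNorm_le_mul_of_isWitness {f : (Fin n → Bool) → Bool}
    {Γ : Matrix (Fin n → Bool) (Fin n → Bool) ℂ} (hΓ : Γ.IsHermitian)
    (hf : ∀ x y, f x = f y → Γ x y = 0) {a : ℝ} (ha : ∀ i, specNorm (diffPart Γ i) ≤ a)
    {X : Matrix ((Fin n → Bool) × Fin n) ((Fin n → Bool) × Fin n) ℂ} (hX : IsWitness f X)
    {W : ℝ} (hW : ∀ s, diagSum X s ≤ W) (ha0 : 0 ≤ a) : specNorm Γ ≤ W * a := by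
  have hW0 : 0 ≤ W := (diagSum_nonneg hX.1 fun _ => true).trans (hW _)
  refine specNorm_le_of_abs_quadForm_le hΓ (mul_nonneg hW0 ha0) fun v => ?_
  have hMul : Γ = Matrix.of fun x y => Γ x y * crossSum X x y := by
    ext x y
    by_cases h : f x = f y
    · simp [hf x y h]
    · simp [hX.crossSum_eq_one h]
  obtain ⟨B, rfl⟩ := hX.1.exists_eq_conjTranspose_mul_self
  rw [hMul, quadForm_mul_crossSum]
  calc |∑ j, ∑ z, quadForm (diffPart Γ j) fun x => B z (x, j) * v x|
      ≤ ∑ j, ∑ z, |quadForm (diffPart Γ j) fun x => B z (x, j) * v x| :=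
        (Finset.abs_sum_le_sum_abs _ _).trans
          (Finset.sum_le_sum fun j _ => Finset.abs_sum_le_sum_abs _ _)
    _ ≤ ∑ j, ∑ z, a * ∑ x, ‖B z (x, j) * v x‖ ^ 2 := by
        refine Finset.sum_le_sum fun j _ => Finset.sum_le_sum fun z _ =>
          (abs_quadForm_le _ _).trans ?_
        gcongr
        exact ha j
    _ = a * ∑ x, diagSum (Bᴴ * B) x * ‖v x‖ ^ 2 := by
        simp only [diagSum_conjTranspose_mul_self, ← Finset.mul_sum, Finset.sum_mul, norm_mul,
          mul_pow]
        congr 1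
        rw [Finset.sum_comm' (t' := Finset.univ) (s' := fun _ => Finset.univ) (by simp)]
        rw [Finset.sum_comm, Finset.sum_comm (s := (Finset.univ : Finset (Fin n → Bool)))]
        refine Finset.sum_congr rfl fun j _ => ?_
        rw [Finset.sum_comm]
    _ ≤ a * ∑ x, W * ‖v x‖ ^ 2 := by
        gcongr
        exact hW _
    _ = W * a * ∑ x, ‖v x‖ ^ 2 := by rw [← Finset.mul_sum]; ring

lemma exists_isWitness (f : (Fin n → Bool) → Bool) : ∃ X, IsWitness f X := by
  let B : Matrix (Fin n → Bool) ((Fin n → Bool) × Fin n) ℂ := Matrix.of fun z p =>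
    if f p.1 then (if z p.2 ≠ p.1 p.2 then ((hammingDist z p.1 : ℕ) : ℂ)⁻¹ else 0)
    else if z = p.1 then 1 else 0
  refine ⟨Bᴴ * B, Matrix.posSemidef_conjTranspose_mul_self B, fun w x hw hx => ?_⟩
  have hwx : w ≠ x := by rintro rfl; simp [hw] at hx
  have h : ∀ j, w j ≠ x j → (Bᴴ * B) (w, j) (x, j) = ((hammingDist w x : ℕ) : ℂ)⁻¹ := by
    intro j hj
    rw [Matrix.mul_apply, Finset.sum_eq_single w]
    · simp [B, hw, hx, hj]
    · intro z _ hz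
      simp [B, hw, hz]
    · simp
  rw [crossSum, Finset.sum_congr rfl fun j hj => h j (Finset.mem_filter.1 hj).2,
    Finset.sum_const, nsmul_eq_mul]
  have : ((hammingDist w x : ℕ) : ℂ) ≠ 0 := by simpa using hwx
  exact mul_inv_cancel₀ this

/-- The pairs `(M, b)` for which some positive semidefinite `X` has constraint values `M` on
`f⁻¹(0) × f⁻¹(1)` and diagonal sums at most `b`. -/
def witnessCone (f : (Fin n → Bool) → Bool) :
    Set (((Fin n → Bool) → (Fin n → Bool) → ℂ) × ((Fin n → Bool) → ℝ)) :=
  {p | ∃ X : Matrix ((Fin n → Bool) × Fin n) ((Fin n → Bool) × Fin n) ℂ, X.PosSemidef ∧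
    (∀ w x, p.1 w x = if f w = false ∧ f x = true then crossSum X w x else 0) ∧
    ∀ s, diagSum X s ≤ p.2 s}

lemma crossSum_add (X Y : Matrix ((Fin n → Bool) × Fin n) ((Fin n → Bool) × Fin n) ℂ)
    (w x : Fin n → Bool) : crossSum (X + Y) w x = crossSum X w x + crossSum Y w x := by
  simp [crossSum, Finset.sum_add_distrib]

lemma diagSum_add (X Y : Matrix ((Fin n → Bool) × Fin n) ((Fin n → Bool) × Fin n) ℂ)
    (s : Fin n → Bool) : diagSum (X + Y) s = diagSum X s + diagSum Y s := by
  simp [diagSum, Finset.sum_add_distrib]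

lemma crossSum_smul (t : ℝ) (X : Matrix ((Fin n → Bool) × Fin n) ((Fin n → Bool) × Fin n) ℂ)
    (w x : Fin n → Bool) : crossSum (t • X) w x = t * crossSum X w x := by
  simp [crossSum, Finset.mul_sum]

lemma diagSum_smul (t : ℝ) (X : Matrix ((Fin n → Bool) × Fin n) ((Fin n → Bool) × Fin n) ℂ)
    (s : Fin n → Bool) : diagSum (t • X) s = t * diagSum X s := by
  simp [diagSum, Finset.mul_sum]

lemma smul_mem_witnessCone {f : (Fin n → Bool) → Bool} {t : ℝ} (ht : 0 ≤ t)
    {p : ((Fin n → Bool) → (Fin n → Bool) → ℂ) × ((Fin n → Bool) → ℝ)}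
    (hp : p ∈ witnessCone f) : t • p ∈ witnessCone f := by
  obtain ⟨X, hX, hc, hd⟩ := hp
  refine ⟨t • X, hX.smul ht, fun w x => ?_, fun s => ?_⟩
  · simp [hc, crossSum_smul]
  · rw [diagSum_smul]
    exact mul_le_mul_of_nonneg_left (hd s) ht

lemma convex_witnessCone (f : (Fin n → Bool) → Bool) : Convex ℝ (witnessCone f) := by
  intro p hp q hq a b ha hb _
  obtain ⟨X, hX, hXc, hXd⟩ := smul_mem_witnessCone ha hp
  obtain ⟨Y, hY, hYc, hYd⟩ := smul_mem_witnessCone hb hq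
  refine ⟨X + Y, hX.add hY, fun w x => ?_, fun s => ?_⟩
  · rw [Prod.fst_add, Pi.add_apply, Pi.add_apply, hXc, hYc, crossSum_add]
    split_ifs <;> simp
  · rw [diagSum_add]
    exact add_le_add (hXd s) (hYd s)

lemma continuous_crossSum (w x : Fin n → Bool) :
    Continuous fun X : Matrix ((Fin n → Bool) × Fin n) ((Fin n → Bool) × Fin n) ℂ =>
      crossSum X w x :=
  continuous_finsetSum _ fun _ _ => continuous_id.matrix_elem _ _

lemma continuous_diagSum (s : Fin n → Bool) :
    Continuous fun X : Matrix ((Fin n → Bool) × Fin n) ((Fin n → Bool) × Fin n) ℂ =>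
      diagSum X s :=
  continuous_finsetSum _ fun _ _ => Complex.continuous_re.comp (continuous_id.matrix_elem _ _)

lemma isClosed_witnessCone (f : (Fin n → Bool) → Bool) : IsClosed (witnessCone f) := by
  refine isClosed_of_closure_subset fun p hp => ?_
  let R : ℝ := ∑ s, |p.2 s| + 1
  let K : Set (Matrix ((Fin n → Bool) × Fin n) ((Fin n → Bool) × Fin n) ℂ) :=
    Set.pi Set.univ fun _ => Set.pi Set.univ fun _ => Metric.closedBall 0 R
  have hK : IsCompact K :=
    isCompact_univ_pi fun _ => isCompact_univ_pi fun _ => isCompact_closedBall _ _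
  have : CompactSpace K := isCompact_iff_compactSpace.1 hK
  let T : Set (K × (((Fin n → Bool) → (Fin n → Bool) → ℂ) × ((Fin n → Bool) → ℝ))) :=
    {q | (∀ w x, q.2.1 w x = if f w = false ∧ f x = true then
        crossSum (q.1.1ᴴ * q.1.1) w x else 0) ∧
      ∀ s, diagSum (q.1.1ᴴ * q.1.1) s ≤ q.2.2 s}
  have hB : Continuous fun q : K × (((Fin n → Bool) → (Fin n → Bool) → ℂ) ×
      ((Fin n → Bool) → ℝ)) => q.1.1ᴴ * q.1.1 := by
    have : Continuous fun q : K × (((Fin n → Bool) → (Fin n → Bool) → ℂ) ×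
      ((Fin n → Bool) → ℝ)) => q.1.1 := continuous_subtype_val.comp continuous_fst
    exact this.matrix_conjTranspose.matrix_mul this
  have hT : IsClosed T := by
    simp only [T, Set.ofPred_and, Set.ofPred_forall]
    refine IsClosed.inter ?_ ?_
    · refine isClosed_iInter fun w => isClosed_iInter fun x => isClosed_eq (by fun_prop) ?_
      split_ifs
      · exact (continuous_crossSum w x).comp hB
      · exact continuous_const
    · exact isClosed_iInter fun s =>
        isClosed_le ((continuous_diagSum s).comp hB) (by fun_prop)
  have hT' : IsClosed (Prod.snd '' T) := isClosedMap_snd_of_compactSpace _ hT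
  have hTsub : Prod.snd '' T ⊆ witnessCone f := by
    rintro _ ⟨q, hq, rfl⟩
    exact ⟨_, Matrix.posSemidef_conjTranspose_mul_self _, hq⟩
  let U : Set (((Fin n → Bool) → (Fin n → Bool) → ℂ) × ((Fin n → Bool) → ℝ)) :=
    {q | ∀ s, q.2 s < p.2 s + 1}
  have hU : IsOpen U := by
    simp only [U, Set.ofPred_forall]
    exact isOpen_iInter_of_finite fun s => isOpen_lt (by fun_prop) continuous_const
  have hsub : U ∩ witnessCone f ⊆ Prod.snd '' T := by
    rintro q ⟨hqU, X, hX, hqc, hqd⟩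
    obtain ⟨B, rfl⟩ := hX.exists_eq_conjTranspose_mul_self
    refine ⟨(⟨B, ?_⟩, q), ⟨hqc, hqd⟩, rfl⟩
    rintro z - ⟨s, j⟩ -
    rw [mem_closedBall_zero_iff]
    have h1 : ‖B z (s, j)‖ ^ 2 ≤ diagSum (Bᴴ * B) s := by
      rw [diagSum_conjTranspose_mul_self]
      exact (Finset.single_le_sum (f := fun z => ‖B z (s, j)‖ ^ 2) (fun _ _ => sq_nonneg _)
        (Finset.mem_univ z)).trans (Finset.single_le_sum
        (f := fun j => ∑ z, ‖B z (s, j)‖ ^ 2)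
        (fun _ _ => Finset.sum_nonneg fun _ _ => sq_nonneg _) (Finset.mem_univ j))
    have h2 : |p.2 s| ≤ ∑ s, |p.2 s| :=
      Finset.single_le_sum (f := fun s => |p.2 s|) (fun _ _ => abs_nonneg _) (Finset.mem_univ s)
    have h3 : diagSum (Bᴴ * B) s ≤ R := by
      have := hqd s; have := hqU s; have := le_abs_self (p.2 s)
      linarith
    have h4 : 1 ≤ R := by
      have := abs_nonneg (p.2 s)
      linarith
    nlinarith [norm_nonneg (B z (s, j))]
  have hpU : p ∈ U := fun s => lt_add_one _
  exact hTsub (hT'.closure_subset_iff.2 hsub (hU.inter_closure ⟨hpU, hp⟩))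

/-- A Farkas-type alternative: if no witness has size at most `W`, there is a dual certificate. -/
lemma exists_dual_certificate {f : (Fin n → Bool) → Bool} {W : ℝ}
    (h : ∀ X, IsWitness f X → ∃ s, W < diagSum X s) :
    ∃ (N : Matrix (Fin n → Bool) (Fin n → Bool) ℂ) (p : (Fin n → Bool) → ℝ),
      (∀ w x, ¬(f w = false ∧ f x = true) → N w x = 0) ∧ (∀ s, 0 ≤ p s) ∧
      (∀ X : Matrix ((Fin n → Bool) × Fin n) ((Fin n → Bool) × Fin n) ℂ, X.PosSemidef →
        (∑ w, ∑ x, N w x * crossSum X w x).re ≤ ∑ s, p s * diagSum X s) ∧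
      W * ∑ s, p s < (∑ w, ∑ x, N w x).re := by
  let J : (Fin n → Bool) → (Fin n → Bool) → ℂ := fun w x =>
    if f w = false ∧ f x = true then 1 else 0
  have hJ : (J, fun _ => W) ∉ witnessCone f := by
    rintro ⟨X, hX, hc, hd⟩
    obtain ⟨s, hs⟩ := h X ⟨hX, fun w x hw hx => by simpa [J, hw, hx] using (hc w x).symm⟩
    exact (hd s).not_gt hs
  obtain ⟨φ, u, hφ, hu⟩ := geometric_hahn_banach_closed_point (convex_witnessCone f)
    (isClosed_witnessCone f) hJ
  have h0 : (0 : ((Fin n → Bool) → (Fin n → Bool) → ℂ) × ((Fin n → Bool) → ℝ)) ∈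
      witnessCone f := ⟨0, .zero, by simp [crossSum], by simp [diagSum]⟩
  have hu0 : 0 < u := by simpa using hφ 0 h0
  have hφ' : ∀ q ∈ witnessCone f, φ q ≤ 0 := by
    intro q hq
    by_contra! hpos
    have := hφ _ (smul_mem_witnessCone (div_pos hu0 hpos).le hq)
    rw [map_smul, smul_eq_mul, div_mul_cancel₀ _ hpos.ne'] at this
    exact this.false
  obtain ⟨γ, hγ⟩ := exists_eq_re_sum_mul (φ.toLinearMap ∘ₗ LinearMap.inl ℝ _ _)
  let p : (Fin n → Bool) → ℝ := fun s => -φ (0, fun t => if s = t then 1 else 0)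
  have hp : ∀ b : (Fin n → Bool) → ℝ, φ (0, b) = -∑ s, p s * b s := by
    intro b
    have := (φ.toLinearMap ∘ₗ LinearMap.inr ℝ _ _).pi_apply_eq_sum_univ b
    simp only [LinearMap.comp_apply, LinearMap.inr_apply, ContinuousLinearMap.coe_coe,
      smul_eq_mul] at this
    rw [this, ← Finset.sum_neg_distrib]
    exact Finset.sum_congr rfl fun s _ => by ring
  have hsplit : ∀ M b, φ (M, b) = (∑ w, ∑ x, γ w x * M w x).re - ∑ s, p s * b s := by
    intro M b
    have h1 : φ (M, 0) = (∑ w, ∑ x, γ w x * M w x).re := hγ M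
    rw [← h1, sub_eq_add_neg, ← hp, ← map_add]
    simp
  refine ⟨Matrix.of fun w x => if f w = false ∧ f x = true then γ w x else 0, p,
    fun w x hwx => if_neg hwx, fun s => ?_, fun X hX => ?_, ?_⟩
  · refine neg_nonneg.2 (hφ' _ ⟨0, .zero, by simp [crossSum], fun t => ?_⟩)
    simp only [diagSum, Matrix.zero_apply, Complex.zero_re, Finset.sum_const_zero]
    split_ifs <;> norm_num
  · have := hφ' (fun w x => if f w = false ∧ f x = true then crossSum X w x else 0, diagSum X)
      ⟨X, hX, fun _ _ => rfl, fun _ => le_rfl⟩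
    rw [hsplit] at this
    simpa only [Matrix.of_apply, ite_mul, zero_mul, mul_ite, mul_zero, sub_nonpos] using this
  · have := hu0.trans hu
    rw [hsplit, sub_pos, ← Finset.sum_mul, mul_comm] at this
    simpa only [Matrix.of_apply, J, mul_ite, mul_one, mul_zero] using this

lemma quadForm_diffPart_le {N : Matrix (Fin n → Bool) (Fin n → Bool) ℂ} {p : (Fin n → Bool) → ℝ}
    (h : ∀ X : Matrix ((Fin n → Bool) × Fin n) ((Fin n → Bool) × Fin n) ℂ, X.PosSemidef →
      (∑ w, ∑ x, N w x * crossSum X w x).re ≤ ∑ s, p s * diagSum X s)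
    (j : Fin n) (v : (Fin n → Bool) → ℂ) :
    quadForm (diffPart N j) v ≤ ∑ s, p s * ‖v s‖ ^ 2 := by
  let a : (Fin n → Bool) × Fin n → ℂ := fun q => if q.2 = j then star (v q.1) else 0
  have hd : ∀ s, diagSum (Matrix.vecMulVec a (star a)) s = ‖v s‖ ^ 2 := by
    intro s
    rw [diagSum, Finset.sum_eq_single j]
    · simp only [Matrix.vecMulVec_apply, a, Pi.star_apply, if_true, star_star]
      rw [Complex.star_def, ← Complex.normSq_eq_conj_mul_self, Complex.ofReal_re, Complex.normSq_eq_norm_sq]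
    · intro k _ hk
      simp [Matrix.vecMulVec_apply, a, hk]
    · simp
  have hc : ∀ w x, crossSum (Matrix.vecMulVec a (star a)) w x =
      if w j ≠ x j then star (v w) * v x else 0 := by
    intro w x
    rw [crossSum, Finset.sum_filter, Finset.sum_eq_single j]
    · simp [Matrix.vecMulVec_apply, a]
    · intro k _ hk
      simp [Matrix.vecMulVec_apply, a, hk]
    · simp
  have := h _ (Matrix.posSemidef_vecMulVec_self_star a)
  simp only [hd, hc] at this
  refine le_of_eq_of_le ?_ this
  rw [quadForm]
  congr 1
  refine Finset.sum_congr rfl fun w _ => Finset.sum_congr rfl fun x _ => ?_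
  rw [diffPart, Matrix.of_apply]
  split_ifs <;> ring

lemma quadForm_sign_flip {f : (Fin n → Bool) → Bool}
    {A : Matrix (Fin n → Bool) (Fin n → Bool) ℂ} (hA : ∀ x y, f x = f y → A x y = 0)
    (v : (Fin n → Bool) → ℂ) :
    quadForm A (fun s => if f s then v s else -v s) = -quadForm A v := by
  rw [quadForm, quadForm, ← Complex.neg_re, ← Finset.sum_neg_distrib]
  congr 1
  refine Finset.sum_congr rfl fun x _ => ?_
  rw [← Finset.sum_neg_distrib]
  refine Finset.sum_congr rfl fun y _ => ?_
  by_cases h : f x = f y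
  · simp [hA x y h]
  · cases hx : f x <;> cases hy : f y <;> simp_all

lemma diffPart_apply_eq_zero {f : (Fin n → Bool) → Bool}
    {Γ : Matrix (Fin n → Bool) (Fin n → Bool) ℂ} (hΓ : ∀ x y, f x = f y → Γ x y = 0) (i : Fin n)
    (x y : Fin n → Bool) (h : f x = f y) : diffPart Γ i x y = 0 := by
  simp [diffPart, hΓ x y h]

lemma Matrix.IsHermitian.diffPart {Γ : Matrix (Fin n → Bool) (Fin n → Bool) ℂ}
    (hΓ : Γ.IsHermitian) (i : Fin n) : (diffPart Γ i).IsHermitian := by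
  ext x y
  simp only [_root_.diffPart, Matrix.conjTranspose_apply, Matrix.of_apply, ne_comm (a := x i),
    apply_ite star, hΓ.apply, star_zero]

/-- Strong duality: if no witness has size at most `W`, some adversary matrix has bound above
`W`. -/
lemma exists_adversary_matrix {f : (Fin n → Bool) → Bool} {W : ℝ}
    (h : ∀ X, IsWitness f X → ∃ s, W < diagSum X s) :
    ∃ Γ : Matrix (Fin n → Bool) (Fin n → Bool) ℂ, Γ.IsHermitian ∧
      (∀ x y, f x = f y → Γ x y = 0) ∧ (∀ i, specNorm (diffPart Γ i) ≤ 1) ∧ W < specNorm Γ := by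
  obtain ⟨N, p, hN, hp, hX, hlt⟩ := exists_dual_certificate h
  obtain ⟨ε, hε, hεlt⟩ := exists_pos_mul_lt (sub_pos.2 hlt) (W * Fintype.card (Fin n → Bool))
  let P : (Fin n → Bool) → ℝ := fun s => p s + ε
  have hP : ∀ s, 0 < P s := fun s => add_pos_of_nonneg_of_pos (hp s) hε
  have hPlt : W * ∑ s, P s < (∑ w, ∑ x, N w x).re := by
    simp only [P, Finset.sum_add_distrib, Finset.sum_const, Finset.card_univ, nsmul_eq_mul]
    linarith
  let c : (Fin n → Bool) → ℝ := fun s => (√(2 * P s))⁻¹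
  have hsq : ∀ s, √(2 * P s) ^ 2 = 2 * P s := fun s => Real.sq_sqrt (by have := hP s; positivity)
  have hc : ∀ s (z : ℂ), P s * ‖(c s : ℂ) * z‖ ^ 2 = ‖z‖ ^ 2 / 2 := by
    intro s z
    have := (hP s).ne'
    rw [norm_mul, mul_pow, Complex.norm_real, Real.norm_eq_abs, sq_abs, inv_pow, hsq]
    field_simp
  let Γ : Matrix (Fin n → Bool) (Fin n → Bool) ℂ :=
    Matrix.of fun x y => (c x : ℂ) * (N + Nᴴ) x y * c y
  have hΓ : Γ.IsHermitian := by
    ext x y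
    simp only [Γ, Matrix.conjTranspose_apply, Matrix.of_apply, Matrix.add_apply, star_mul',
      star_add, star_star]
    simp only [Complex.star_def, Complex.conj_ofReal]
    ring
  have hΓf : ∀ x y, f x = f y → Γ x y = 0 := by
    intro x y hxy
    have h1 : N x y = 0 := hN x y (by rintro ⟨h1, h2⟩; simp [h1, h2] at hxy)
    have h2 : N y x = 0 := hN y x (by rintro ⟨h1, h2⟩; simp [h1, h2] at hxy)
    simp [Γ, h1, h2]
  have hdiff : ∀ i v, quadForm (diffPart Γ i) v =
      2 * quadForm (diffPart N i) fun s => (c s : ℂ) * v s := by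
    intro i v
    rw [← quadForm_add_conjTranspose, ← quadForm_of_mul_mul]
    congr 1
    ext x y
    simp only [diffPart, Γ, Matrix.of_apply, Matrix.add_apply, Matrix.conjTranspose_apply,
      ne_comm (a := y i)]
    split_ifs <;> simp
  have hle : ∀ i v, quadForm (diffPart Γ i) v ≤ 1 * ∑ s, ‖v s‖ ^ 2 := by
    intro i v
    have hi : quadForm (diffPart N i) (fun s => (c s : ℂ) * v s) ≤
        ∑ s, P s * ‖(c s : ℂ) * v s‖ ^ 2 :=
      (quadForm_diffPart_le hX i _).trans (by gcongr; exact le_add_of_nonneg_right hε.le)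
    simp only [hc, ← Finset.sum_div] at hi
    rw [hdiff]
    linarith
  refine ⟨Γ, hΓ, hΓf, fun i => ?_, ?_⟩
  · refine specNorm_le_of_abs_quadForm_le (hΓ.diffPart i) zero_le_one fun v =>
      abs_le'.2 ⟨hle i v, ?_⟩
    rw [← quadForm_sign_flip (diffPart_apply_eq_zero hΓf i)]
    refine (hle i _).trans_eq ?_
    congr 1
    refine Finset.sum_congr rfl fun s _ => ?_
    split_ifs <;> simp
  · have hv := (le_abs_self _).trans (abs_quadForm_le Γ fun s => (√(2 * P s) : ℂ))
    have h1 : ∀ s, (c s : ℂ) * (√(2 * P s) : ℂ) = 1 := fun s => by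
      rw [← Complex.ofReal_mul, inv_mul_cancel₀, Complex.ofReal_one]
      have := hP s
      positivity
    rw [quadForm_of_mul_mul, quadForm_add_conjTranspose] at hv
    simp only [h1, quadForm, star_one, one_mul, mul_one, Complex.norm_real, Real.norm_eq_abs,
      sq_abs, hsq, ← Finset.mul_sum] at hv
    have hPpos : 0 < ∑ s, P s := Finset.sum_pos (fun s _ => hP s) Finset.univ_nonempty
    nlinarith

end Adversary

/-- **The dual of the general adversary bound is span program witness size.**
For a nonconstant `f : {0,1}ⁿ → {0,1}`, the supremum over nonzero adversary
matrices `Γ` of `‖Γ‖ / max_i ‖Γ ∘ D_i‖` equals the infimum, over positive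
semidefinite matrices `X` indexed by `{0,1}ⁿ × [n]` satisfying
`Σ_{j : w_j ≠ x_j} ⟨w,j|X|x,j⟩ = 1` for all `w ∈ f⁻¹(0)`, `x ∈ f⁻¹(1)`, of
`max_s Σ_j ⟨s,j|X|s,j⟩`. -/
theorem general_adversary_bound_eq_witness_size_sdp
    {n : ℕ} (f : (Fin n → Bool) → Bool) (hf : ∃ x y, f x ≠ f y) :
    sSup {r : ℝ | ∃ Γ : Matrix (Fin n → Bool) (Fin n → Bool) ℂ,
        Γ.IsHermitian ∧ (∀ x y, f x = f y → Γ x y = 0) ∧ Γ ≠ 0 ∧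
        r = specNorm Γ /
          ⨆ i : Fin n,
            specNorm (Matrix.of fun x y => if x i ≠ y i then Γ x y else 0)} =
    sInf {r : ℝ | ∃ X : Matrix ((Fin n → Bool) × Fin n) ((Fin n → Bool) × Fin n) ℂ,
        X.PosSemidef ∧
        (∀ w x, f w = false → f x = true →
          ∑ j ∈ Finset.univ.filter (fun j => w j ≠ x j), X (w, j) (x, j) = 1) ∧
        r = ⨆ s : Fin n → Bool, ∑ j : Fin n, (X (s, j) (s, j)).re} := by
  let L : Set ℝ := {r : ℝ | ∃ Γ : Matrix (Fin n → Bool) (Fin n → Bool) ℂ,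
    Γ.IsHermitian ∧ (∀ x y, f x = f y → Γ x y = 0) ∧ Γ ≠ 0 ∧
    r = specNorm Γ / ⨆ i : Fin n, specNorm (diffPart Γ i)}
  let R : Set ℝ := {r : ℝ | ∃ X, IsWitness f X ∧ r = ⨆ s, diagSum X s}
  have hR : {r : ℝ | ∃ X : Matrix ((Fin n → Bool) × Fin n) ((Fin n → Bool) × Fin n) ℂ,
        X.PosSemidef ∧
        (∀ w x, f w = false → f x = true →
          ∑ j ∈ Finset.univ.filter (fun j => w j ≠ x j), X (w, j) (x, j) = 1) ∧
        r = ⨆ s : Fin n → Bool, ∑ j : Fin n, (X (s, j) (s, j)).re} = R :=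
    Set.ext fun r => exists_congr fun X => and_assoc.symm
  rw [hR]
  change sSup L = sInf R
  have hLR : ∀ a ∈ L, ∀ b ∈ R, a ≤ b := by
    rintro _ ⟨Γ, hΓ, hΓf, -, rfl⟩ _ ⟨X, hX, rfl⟩
    have hW : ∀ s, diagSum X s ≤ ⨆ s, diagSum X s := le_ciSup (Set.finite_range _).bddAbove
    have hnonneg : 0 ≤ ⨆ i, specNorm (diffPart Γ i) := Real.iSup_nonneg fun i => specNorm_nonneg _
    exact div_le_of_le_mul₀ hnonneg (Real.iSup_nonneg (diagSum_nonneg hX.1))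
      (specNorm_le_mul_of_isWitness hΓ hΓf (le_ciSup (Set.finite_range _).bddAbove) hX hW hnonneg)
  obtain ⟨X₀, hX₀⟩ := exists_isWitness f
  have hRne : R.Nonempty := ⟨_, X₀, hX₀, rfl⟩
  have hLne : L.Nonempty := by
    obtain ⟨x, y, hxy⟩ := hf
    refine ⟨_, Matrix.of fun x y => if f x = f y then 0 else 1, ?_, fun x y h => by simp [h], ?_,
      rfl⟩
    · ext x y
      simp [eq_comm (a := f x), apply_ite]
    · intro h
      simpa [hxy] using congrFun (congrFun h x) y
  refine le_antisymm (csSup_le hLne fun a ha => le_csInf hRne (hLR a ha)) ?_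
  by_contra! hlt
  obtain ⟨W, hLW, hWR⟩ := exists_between hlt
  have hLbdd : BddAbove L := ⟨_, fun a ha => hLR a ha _ hRne.some_mem⟩
  have hLnonneg : ∀ a ∈ L, 0 ≤ a := by
    rintro _ ⟨Γ, -, -, -, rfl⟩
    exact div_nonneg (specNorm_nonneg _) (Real.iSup_nonneg fun i => specNorm_nonneg _)
  have hRbdd : BddBelow R := ⟨_, fun b hb => hLR _ hLne.some_mem b hb⟩
  have hW0 : 0 ≤ W := (Real.sSup_nonneg hLnonneg).trans hLW.le
  obtain ⟨Γ, hΓ, hΓf, hΓ1, hΓW⟩ := exists_adversary_matrix (f := f) fun X hX => by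
    by_contra! hle
    exact (hWR.trans_le (csInf_le hRbdd ⟨X, hX, rfl⟩)).not_ge (ciSup_le hle)
  have hpos : 0 < ⨆ i, specNorm (diffPart Γ i) := by
    refine (Real.iSup_nonneg fun i => specNorm_nonneg _).lt_of_ne fun h0 => ?_
    have := specNorm_le_mul_of_isWitness hΓ hΓf
      (fun i => (le_ciSup (Set.finite_range _).bddAbove i).trans_eq h0.symm) hX₀
      (le_ciSup (Set.finite_range _).bddAbove) le_rfl
    linarith
  have hΓ0 : Γ ≠ 0 := by
    rintro rfl
    have : specNorm (0 : Matrix (Fin n → Bool) (Fin n → Bool) ℂ) = 0 := by simp [specNorm]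
    linarith
  have hmem := le_csSup hLbdd ⟨Γ, hΓ, hΓf, hΓ0, rfl⟩
  have : W < specNorm Γ / ⨆ i, specNorm (diffPart Γ i) :=
    hΓW.trans_le (le_div_self (specNorm_nonneg _) hpos (Real.iSup_le hΓ1 zero_le_one))
  linarith
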